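/- For all a1, a2, a3, a4, a5 in F, [a1,a2,a5][a3,a4] + [a1,a2][a3,a4,a5] = 0; that is, the polynomial [t1,t2,t5][t3,t4] + [t1,t2][t3,t4,t5] is a polynomial identity of F. -/

import Mathlib

open scoped TensorProduct

noncomputable section

/-- The free supercommutative algebra on four even variables `x1, x2, x1', x2'` and four odd
variables `y1, y2, y1', y2'`: the tensor product of a polynomial ring in four variables with
the exterior algebra on a four-dimensional space. -/
abbrev FreeSuperComm (K : Type*) [Field K] :=
  (MvPolynomial (Fin 4) K) ⊗[K] (ExteriorAlgebra K (Fin 4 → K))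

/-- The even generators: `xg K 0 = x1`, `xg K 1 = x1'`, `xg K 2 = x2`, `xg K 3 = x2'`. -/
def xg (K : Type*) [Field K] (i : Fin 4) : FreeSuperComm K :=
  (MvPolynomial.X i) ⊗ₜ[K] 1

/-- The odd generators: `yg K 0 = y1`, `yg K 1 = y1'`, `yg K 2 = y2`, `yg K 3 = y2'`. -/
def yg (K : Type*) [Field K] (i : Fin 4) : FreeSuperComm K :=
  1 ⊗ₜ[K] (ExteriorAlgebra.ι K (Pi.single i 1))

/-- The generic matrix `C1 = (x1, y1; y1', x1')`. -/
def genC₁ (K : Type*) [Field K] : Matrix (Fin 2) (Fin 2) (FreeSuperComm K) :=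
  !![xg K 0, yg K 0; yg K 1, xg K 1]

/-- The generic matrix `C2 = (x2, y2; y2', x2')`. -/
def genC₂ (K : Type*) [Field K] : Matrix (Fin 2) (Fin 2) (FreeSuperComm K) :=
  !![xg K 2, yg K 2; yg K 3, xg K 3]

/-- `F = K[C1, C2]`, the unital subalgebra generated by the two generic matrices. -/
def Falg (K : Type*) [Field K] : Subalgebra K (Matrix (Fin 2) (Fin 2) (FreeSuperComm K)) :=
  Algebra.adjoin K {genC₁ K, genC₂ K}

section helper

variable {S R : Type*} [CommRing S] [Ring R] [Algebra S R]

/-- anticommuting quadruple -/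
structure Anti4 (y1 y2 z1 z2 : R) : Prop where
  a1 : y1 * y1 = 0
  a2 : y2 * y2 = 0
  a3 : z1 * z1 = 0
  a4 : z2 * z2 = 0
  b1 : y2 * y1 = -(y1 * y2)
  b2 : z2 * z1 = -(z1 * z2)
  b3 : z1 * y1 = -(y1 * z1)
  b4 : z1 * y2 = -(y2 * z1)
  b5 : z2 * y1 = -(y1 * z2)
  b6 : z2 * y2 = -(y2 * z2)

theorem Anti4.l {a b : R} (h : b * a = -(a * b)) (c : R) : b * (a * c) = -(a * (b * c)) := by
  rw [← mul_assoc, h, neg_mul, mul_assoc]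

theorem Anti4.z {a : R} (h : a * a = 0) (c : R) : a * (a * c) = 0 := by
  rw [← mul_assoc, h, zero_mul]

/-- the good form of a matrix in F -/
def GoodM (y1 y2 z1 z2 : R) (d1 d2 : S) (I : Ideal S) (M : Matrix (Fin 2) (Fin 2) R) : Prop :=
  ∃ p s α β γ δ : S, M = !![p • 1, α • y1 + β • y2; γ • z1 + δ • z2, s • 1] ∧
    p - s - (α * d1 + β * d2) ∈ I ∧ p - s - (γ * d1 + δ * d2) ∈ I

theorem GoodM.add {y1 y2 z1 z2 : R} {d1 d2 : S} {I : Ideal S} {M N : Matrix (Fin 2) (Fin 2) R}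
    (hM : GoodM y1 y2 z1 z2 d1 d2 I M) (hN : GoodM y1 y2 z1 z2 d1 d2 I N) :
    GoodM y1 y2 z1 z2 d1 d2 I (M + N) := by
  obtain ⟨p, s, α, β, γ, δ, rfl, h1, h2⟩ := hM
  obtain ⟨p', s', α', β', γ', δ', rfl, h1', h2'⟩ := hN
  refine ⟨p + p', s + s', α + α', β + β', γ + γ', δ + δ', ?_, ?_, ?_⟩
  · ext i j
    fin_cases i <;> fin_cases j <;> simp <;> module
  · convert I.add_mem h1 h1' using 1; ring
  · convert I.add_mem h2 h2' using 1; ring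

theorem GoodM.scalar (y1 y2 z1 z2 : R) (d1 d2 : S) (I : Ideal S) (c : S) :
    GoodM y1 y2 z1 z2 d1 d2 I (!![c • 1, 0; 0, c • 1]) := by
  refine ⟨c, c, 0, 0, 0, 0, ?_, ?_, ?_⟩ <;> simp

theorem GoodM.mul {y1 y2 z1 z2 : R} (h : Anti4 y1 y2 z1 z2) {d1 d2 : S} {I : Ideal S}
    {m11 m12 m21 m22 : S} (e11 : m11 • (1 : R) = y1 * z1) (e12 : m12 • (1 : R) = y1 * z2)
    (e21 : m21 • (1 : R) = y2 * z1) (e22 : m22 • (1 : R) = y2 * z2)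
    (i11 : m11 ∈ I) (i12 : m12 ∈ I) (i21 : m21 ∈ I) (i22 : m22 ∈ I)
    {M N : Matrix (Fin 2) (Fin 2) R}
    (hM : GoodM y1 y2 z1 z2 d1 d2 I M) (hN : GoodM y1 y2 z1 z2 d1 d2 I N) :
    GoodM y1 y2 z1 z2 d1 d2 I (M * N) := by
  obtain ⟨p, s, α, β, γ, δ, rfl, h1, h2⟩ := hM
  obtain ⟨p', s', α', β', γ', δ', rfl, h1', h2'⟩ := hN
  refine ⟨p * p' + (α * γ' * m11 + α * δ' * m12 + β * γ' * m21 + β * δ' * m22),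
    s * s' - (α' * γ * m11 + α' * δ * m12 + β' * γ * m21 + β' * δ * m22),
    p * α' + α * s', p * β' + β * s', γ * p' + s * γ', δ * p' + s * δ', ?_, ?_, ?_⟩
  · ext i j
    fin_cases i <;> fin_cases j
    · simp [Matrix.mul_apply, Fin.sum_univ_two, add_smul, mul_smul, e11, e12, e21, e22,
        mul_add, add_mul]
      module
    · simp [Matrix.mul_apply, Fin.sum_univ_two]
      module
    · simp [Matrix.mul_apply, Fin.sum_univ_two]
      module
    · simp [Matrix.mul_apply, Fin.sum_univ_two, add_smul, sub_smul, mul_smul, e11, e12, e21, e22,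
        mul_add, add_mul, h.b3, h.b4, h.b5, h.b6]
      module
  all_goals
    rw [← Ideal.Quotient.eq_zero_iff_mem] at *
    simp only [map_add, map_sub, map_mul] at *
    simp only [i11, i12, i21, i22]
  · linear_combination (Ideal.Quotient.mk I p) * h1' + (Ideal.Quotient.mk I s') * h1
  · linear_combination (Ideal.Quotient.mk I s) * h2' + (Ideal.Quotient.mk I p') * h2

theorem comm_form {y1 y2 z1 z2 : R} (h : Anti4 y1 y2 z1 z2)
    (p s α β γ δ p' s' α' β' γ' δ' : S) :
    (!![p • 1, α • y1 + β • y2; γ • z1 + δ • z2, s • 1] : Matrix (Fin 2) (Fin 2) R) *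
      !![p' • 1, α' • y1 + β' • y2; γ' • z1 + δ' • z2, s' • 1] -
      !![p' • 1, α' • y1 + β' • y2; γ' • z1 + δ' • z2, s' • 1] *
      !![p • 1, α • y1 + β • y2; γ • z1 + δ • z2, s • 1] =
    !![(α * γ' - α' * γ) • (y1 * z1) + (α * δ' - α' * δ) • (y1 * z2)
        + (β * γ' - β' * γ) • (y2 * z1) + (β * δ' - β' * δ) • (y2 * z2),
      ((p - s) * α' - (p' - s') * α) • y1 + ((p - s) * β' - (p' - s') * β) • y2;
      ((p' - s') * γ - (p - s) * γ') • z1 + ((p' - s') * δ - (p - s) * δ') • z2,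
      (α * γ' - α' * γ) • (y1 * z1) + (α * δ' - α' * δ) • (y1 * z2)
        + (β * γ' - β' * γ) • (y2 * z1) + (β * δ' - β' * δ) • (y2 * z2)] := by
  ext i j
  fin_cases i <;> fin_cases j <;>
    simp [Matrix.mul_apply, Fin.sum_univ_two, mul_add, add_mul, h.b3, h.b4, h.b5, h.b6] <;>
    module

theorem prod_form {y1 y2 z1 z2 : R} (h : Anti4 y1 y2 z1 z2)
    (p s α β γ δ c11 c12 c21 c22 k1 k2 l1 l2 c11' c12' c21' c22' k1' k2' l1' l2' : S)
    {G1 G2 H1 H2 : S}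
    (hG1 : c21 * k1' - c11 * k2' + c21' * k1 - c11' * k2 = G1)
    (hG2 : c22 * k1' - c12 * k2' + c22' * k1 - c12' * k2 = G2)
    (hH1 : c11 * l2' - c12 * l1' + c11' * l2 - c12' * l1 = H1)
    (hH2 : c21 * l2' - c22 * l1' + c21' * l2 - c22' * l1 = H2)
    {u v a : Matrix (Fin 2) (Fin 2) R}
    (hu : u = !![c11 • (y1 * z1) + c12 • (y1 * z2) + c21 • (y2 * z1) + c22 • (y2 * z2),
      k1 • y1 + k2 • y2; l1 • z1 + l2 • z2,
      c11 • (y1 * z1) + c12 • (y1 * z2) + c21 • (y2 * z1) + c22 • (y2 * z2)])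
    (hv : v = !![c11' • (y1 * z1) + c12' • (y1 * z2) + c21' • (y2 * z1) + c22' • (y2 * z2),
      k1' • y1 + k2' • y2; l1' • z1 + l2' • z2,
      c11' • (y1 * z1) + c12' • (y1 * z2) + c21' • (y2 * z1) + c22' • (y2 * z2)])
    (ha : a = !![p • 1, α • y1 + β • y2; γ • z1 + δ • z2, s • 1]) :
    u * v * a - a * (u * v) =
    !![(G1 * δ - G2 * γ - α * H2 + β * H1) • (y1 * (y2 * (z1 * z2))),
      ((s - p) * G1 + l1' * (k2 * α - k1 * β) + l1 * (α * k2' - β * k1')) • (y1 * (y2 * z1)) +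
      ((s - p) * G2 + l2' * (k2 * α - k1 * β) + l2 * (α * k2' - β * k1')) • (y1 * (y2 * z2));
      ((p - s) * H1 - k1' * (l1 * δ - l2 * γ) + k1 * (γ * l2' - δ * l1')) • (y1 * (z1 * z2)) +
      ((p - s) * H2 - k2' * (l1 * δ - l2 * γ) + k2 * (γ * l2' - δ * l1')) • (y2 * (z1 * z2)),
      (G1 * δ - G2 * γ - α * H2 + β * H1) • (y1 * (y2 * (z1 * z2)))] := by
  subst hG1 hG2 hH1 hH2
  have huv : u * v = !![
    (c11*c22' + c22*c11' - c12*c21' - c21*c12') • -(y1 * (y2 * (z1 * z2))) +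
     (k1*l1') • (y1*z1) + (k1*l2') • (y1*z2) + (k2*l1') • (y2*z1) + (k2*l2') • (y2*z2),
    (c21 * k1' - c11 * k2' + c21' * k1 - c11' * k2) • (y1 * (y2 * z1)) +
    (c22 * k1' - c12 * k2' + c22' * k1 - c12' * k2) • (y1 * (y2 * z2));
    (c11 * l2' - c12 * l1' + c11' * l2 - c12' * l1) • (y1 * (z1 * z2)) +
    (c21 * l2' - c22 * l1' + c21' * l2 - c22' * l1) • (y2 * (z1 * z2)),
    (c11*c22' + c22*c11' - c12*c21' - c21*c12') • -(y1 * (y2 * (z1 * z2))) -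
     ((k1'*l1) • (y1*z1) + (k1'*l2) • (y1*z2) + (k2'*l1) • (y2*z1) + (k2'*l2) • (y2*z2))] := by
    subst hu hv
    ext i j
    fin_cases i <;> fin_cases j <;>
      simp [Matrix.mul_apply, Fin.sum_univ_two, mul_add, add_mul, mul_assoc,
        h.b1, h.b2, h.b3, h.b4, h.b5, h.b6, h.a1, h.a2, h.a3, h.a4,
        Anti4.l h.b1, Anti4.l h.b2, Anti4.l h.b3, Anti4.l h.b4, Anti4.l h.b5, Anti4.l h.b6,
        Anti4.z h.a1, Anti4.z h.a2, Anti4.z h.a3, Anti4.z h.a4] <;>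
      module
  rw [huv]
  subst ha
  ext i j
  fin_cases i <;> fin_cases j <;>
      simp [Matrix.mul_apply, Fin.sum_univ_two, mul_add, add_mul, sub_mul, mul_sub, mul_assoc,
        h.b1, h.b2, h.b3, h.b4, h.b5, h.b6, h.a1, h.a2, h.a3, h.a4,
        Anti4.l h.b1, Anti4.l h.b2, Anti4.l h.b3, Anti4.l h.b4, Anti4.l h.b5, Anti4.l h.b6,
        Anti4.z h.a1, Anti4.z h.a2, Anti4.z h.a3, Anti4.z h.a4] <;>
      module

theorem comm_id {T : Type*} [CommRing T]
    {d1 d2 D1 D2 D3 D4 D5 α1 α2 α3 α4 α5 β1 β2 β3 β4 β5 γ1 γ2 γ3 γ4 γ5 δ1 δ2 δ3 δ4 δ5 : T}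
    (f1 : D1 = α1 * d1 + β1 * d2) (f2 : D2 = α2 * d1 + β2 * d2) (f3 : D3 = α3 * d1 + β3 * d2)
    (f4 : D4 = α4 * d1 + β4 * d2) (f5 : D5 = α5 * d1 + β5 * d2)
    (g1 : D1 = γ1 * d1 + δ1 * d2) (g2 : D2 = γ2 * d1 + δ2 * d2) (g3 : D3 = γ3 * d1 + δ3 * d2)
    (g4 : D4 = γ4 * d1 + δ4 * d2) (g5 : D5 = γ5 * d1 + δ5 * d2) {G1 G2 H1 H2 : T}
    (hG1 : G1 = (β1 * γ2 - β2 * γ1) * (D3 * α4 - D4 * α3)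
      - (α1 * γ2 - α2 * γ1) * (D3 * β4 - D4 * β3)
      + (β3 * γ4 - β4 * γ3) * (D1 * α2 - D2 * α1) - (α3 * γ4 - α4 * γ3) * (D1 * β2 - D2 * β1))
    (hG2 : G2 = (β1 * δ2 - β2 * δ1) * (D3 * α4 - D4 * α3)
      - (α1 * δ2 - α2 * δ1) * (D3 * β4 - D4 * β3)
      + (β3 * δ4 - β4 * δ3) * (D1 * α2 - D2 * α1) - (α3 * δ4 - α4 * δ3) * (D1 * β2 - D2 * β1))
    (hH1 : H1 = (α1 * γ2 - α2 * γ1) * (D4 * δ3 - D3 * δ4)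
      - (α1 * δ2 - α2 * δ1) * (D4 * γ3 - D3 * γ4)
      + (α3 * γ4 - α4 * γ3) * (D2 * δ1 - D1 * δ2) - (α3 * δ4 - α4 * δ3) * (D2 * γ1 - D1 * γ2))
    (hH2 : H2 = (β1 * γ2 - β2 * γ1) * (D4 * δ3 - D3 * δ4)
      - (β1 * δ2 - β2 * δ1) * (D4 * γ3 - D3 * γ4)
      + (β3 * γ4 - β4 * γ3) * (D2 * δ1 - D1 * δ2) - (β3 * δ4 - β4 * δ3) * (D2 * γ1 - D1 * γ2)) :
    G1 * δ5 - G2 * γ5 - α5 * H2 + β5 * H1 = 0 := by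
  have eG1 : G1 = (α3 * β4 - α4 * β3) * (D2 * γ1 - D1 * γ2)
      + (α1 * β2 - α2 * β1) * (D4 * γ3 - D3 * γ4) := by rw [hG1, f1, f2, f3, f4]; ring
  have eG2 : G2 = (α3 * β4 - α4 * β3) * (D2 * δ1 - D1 * δ2)
      + (α1 * β2 - α2 * β1) * (D4 * δ3 - D3 * δ4) := by rw [hG2, f1, f2, f3, f4]; ring
  have eH1 : H1 = -(γ3 * δ4 - γ4 * δ3) * (D2 * α1 - D1 * α2)
      - (γ1 * δ2 - γ2 * δ1) * (D4 * α3 - D3 * α4) := by rw [hH1, g1, g2, g3, g4]; ring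
  have eH2 : H2 = -(γ3 * δ4 - γ4 * δ3) * (D2 * β1 - D1 * β2)
      - (γ1 * δ2 - γ2 * δ1) * (D4 * β3 - D3 * β4) := by rw [hH2, g1, g2, g3, g4]; ring
  have k1 : D2 * α1 - D1 * α2 = (α1 * β2 - α2 * β1) * d2 := by rw [f1, f2]; ring
  have k2 : D2 * β1 - D1 * β2 = -(α1 * β2 - α2 * β1) * d1 := by rw [f1, f2]; ring
  have k3 : D4 * α3 - D3 * α4 = (α3 * β4 - α4 * β3) * d2 := by rw [f3, f4]; ring
  have k4 : D4 * β3 - D3 * β4 = -(α3 * β4 - α4 * β3) * d1 := by rw [f3, f4]; ring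
  have l1 : D2 * γ1 - D1 * γ2 = (γ1 * δ2 - γ2 * δ1) * d2 := by rw [g1, g2]; ring
  have l2 : D2 * δ1 - D1 * δ2 = -(γ1 * δ2 - γ2 * δ1) * d1 := by rw [g1, g2]; ring
  have l3 : D4 * γ3 - D3 * γ4 = (γ3 * δ4 - γ4 * δ3) * d2 := by rw [g3, g4]; ring
  have l4 : D4 * δ3 - D3 * δ4 = -(γ3 * δ4 - γ4 * δ3) * d1 := by rw [g3, g4]; ring
  rw [eG1, eG2, eH1, eH2, k1, k2, k3, k4, l1, l2, l3, l4]
  linear_combination ((α3 * β4 - α4 * β3) * (γ1 * δ2 - γ2 * δ1)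
    + (α1 * β2 - α2 * β1) * (γ3 * δ4 - γ4 * δ3)) * (f5 - g5)

theorem main_gen {y1 y2 z1 z2 : R} (h : Anti4 y1 y2 z1 z2) {d1 d2 : S} {I : Ideal S}
    (hy : ∀ n ∈ I, n • (y1 * y2) = 0) (hz : ∀ n ∈ I, n • (z1 * z2) = 0)
    {a₁ a₂ a₃ a₄ a₅ : Matrix (Fin 2) (Fin 2) R}
    (h₁ : GoodM y1 y2 z1 z2 d1 d2 I a₁) (h₂ : GoodM y1 y2 z1 z2 d1 d2 I a₂)
    (h₃ : GoodM y1 y2 z1 z2 d1 d2 I a₃) (h₄ : GoodM y1 y2 z1 z2 d1 d2 I a₄)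
    (h₅ : GoodM y1 y2 z1 z2 d1 d2 I a₅) :
    (a₁ * a₂ - a₂ * a₁) * (a₃ * a₄ - a₄ * a₃) * a₅ -
      a₅ * ((a₁ * a₂ - a₂ * a₁) * (a₃ * a₄ - a₄ * a₃)) = 0 := by
  have hyz : ∀ n ∈ I, ∀ r, n • (y1 * (y2 * r)) = 0 := fun n hn r => by
    rw [← mul_assoc, ← smul_mul_assoc, hy n hn, zero_mul]
  have hzy : ∀ n ∈ I, ∀ r, n • (r * (z1 * z2)) = 0 := fun n hn r => by
    rw [← mul_smul_comm, hz n hn, mul_zero]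
  obtain ⟨p1, s1, α1, β1, γ1, δ1, e1, f1, g1⟩ := h₁
  obtain ⟨p2, s2, α2, β2, γ2, δ2, e2, f2, g2⟩ := h₂
  obtain ⟨p3, s3, α3, β3, γ3, δ3, e3, f3, g3⟩ := h₃
  obtain ⟨p4, s4, α4, β4, γ4, δ4, e4, f4, g4⟩ := h₄
  obtain ⟨p5, s5, α5, β5, γ5, δ5, e5, f5, g5⟩ := h₅
  have hu := comm_form h p1 s1 α1 β1 γ1 δ1 p2 s2 α2 β2 γ2 δ2
  have hv := comm_form h p3 s3 α3 β3 γ3 δ3 p4 s4 α4 β4 γ4 δ4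
  rw [← e1, ← e2] at hu
  rw [← e3, ← e4] at hv
  rw [prod_form h p5 s5 α5 β5 γ5 δ5 _ _ _ _ _ _ _ _ _ _ _ _ _ _ _ _ rfl rfl rfl rfl hu hv e5]
  clear hu hv e1 e2 e3 e4 e5
  rw [← Ideal.Quotient.eq_zero_iff_mem] at f1 g1 f2 g2 f3 g3 f4 g4 f5 g5
  simp only [map_add, map_sub, map_mul] at f1 g1 f2 g2 f3 g3 f4 g4 f5 g5
  have F1 := sub_eq_zero.1 f1
  have Fx1 := sub_eq_iff_eq_add.1 F1
  have G1 := sub_eq_zero.1 g1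
  have Gx1 := sub_eq_iff_eq_add.1 G1
  have F2 := sub_eq_zero.1 f2
  have Fx2 := sub_eq_iff_eq_add.1 F2
  have G2 := sub_eq_zero.1 g2
  have Gx2 := sub_eq_iff_eq_add.1 G2
  have F3 := sub_eq_zero.1 f3
  have Fx3 := sub_eq_iff_eq_add.1 F3
  have G3 := sub_eq_zero.1 g3
  have Gx3 := sub_eq_iff_eq_add.1 G3
  have F4 := sub_eq_zero.1 f4
  have Fx4 := sub_eq_iff_eq_add.1 F4
  have G4 := sub_eq_zero.1 g4
  have Gx4 := sub_eq_iff_eq_add.1 G4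
  have F5 := sub_eq_zero.1 f5
  have Fx5 := sub_eq_iff_eq_add.1 F5
  have G5 := sub_eq_zero.1 g5
  have Gx5 := sub_eq_iff_eq_add.1 G5
  ext i j
  fin_cases i <;> fin_cases j
  · refine hyz _ ?_ _
    rw [← Ideal.Quotient.eq_zero_iff_mem]
    simp only [map_add, map_sub, map_mul]
    exact comm_id F1 F2 F3 F4 F5 G1 G2 G3 G4 G5 rfl rfl rfl rfl
  · refine (congrArg₂ (· + ·) (hyz _ ?_ _) (hyz _ ?_ _)).trans (add_zero 0) <;>
    rw [← Ideal.Quotient.eq_zero_iff_mem] <;>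
    simp only [map_add, map_sub, map_mul] <;> simp only [Fx1, Fx2, Fx3, Fx4, Fx5]  <;>
    ring
  · refine (congrArg₂ (· + ·) (hzy _ ?_ _) (hzy _ ?_ _)).trans (add_zero 0) <;>
    rw [← Ideal.Quotient.eq_zero_iff_mem] <;>
    simp only [map_add, map_sub, map_mul] <;> simp only [Gx1, Gx2, Gx3, Gx4, Gx5]  <;>
    ring
  · refine hyz _ ?_ _
    rw [← Ideal.Quotient.eq_zero_iff_mem]
    simp only [map_add, map_sub, map_mul]
    exact comm_id F1 F2 F3 F4 F5 G1 G2 G3 G4 G5 rfl rfl rfl rfl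

end helper

section final

variable (K : Type*) [Field K]

/-- the center as a bare type -/
def Cen (R : Type*) [Ring R] : Type _ := Subring.center R

instance cenRing (R : Type*) [Ring R] : CommRing (Cen R) :=
  inferInstanceAs (CommRing (Subring.center R))

instance cenAlg (R : Type*) [Ring R] : Algebra (Cen R) R :=
  RingHom.toAlgebra' (R := Cen R) (Subring.center R).subtype
    fun c x => (Subring.mem_center_iff.1 c.2 x).symm

theorem center_smul {R : Type*} [Ring R] (c : Cen R) (x : R) : c • x = c.1 * x :=
  rfl

theorem yg_sq (i : Fin 4) : yg K i * yg K i = 0 := by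
  simp [yg]

theorem yg_anti (i j : Fin 4) : yg K i * yg K j = -(yg K j * yg K i) := by
  have := ExteriorAlgebra.ι_add_mul_swap (R := K) (M := Fin 4 → K) (Pi.single i 1) (Pi.single j 1)
  rw [eq_neg_iff_add_eq_zero]
  simp only [yg, Algebra.TensorProduct.tmul_mul_tmul, mul_one, ← TensorProduct.tmul_add, this,
    TensorProduct.tmul_zero]

theorem xg_comm (i : Fin 4) (r : FreeSuperComm K) : r * xg K i = xg K i * r := by
  induction r using TensorProduct.induction_on with
  | zero => simp
  | add a b ha hb => rw [add_mul, mul_add, ha, hb]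
  | tmul a b => simp [xg, mul_comm]

theorem even_comm (i j : Fin 4) (r : FreeSuperComm K) :
    r * (yg K i * yg K j) = (yg K i * yg K j) * r := by
  have key : ∀ b : ExteriorAlgebra K (Fin 4 → K), ∀ v w : Fin 4 → K,
      b * (ExteriorAlgebra.ι K v * ExteriorAlgebra.ι K w) =
      (ExteriorAlgebra.ι K v * ExteriorAlgebra.ι K w) * b := by
    intro b v w
    have sw : ∀ a b : Fin 4 → K, ExteriorAlgebra.ι K a * ExteriorAlgebra.ι K b =
        -(ExteriorAlgebra.ι K b * ExteriorAlgebra.ι K a) := fun a b =>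
      eq_neg_iff_add_eq_zero.2 (ExteriorAlgebra.ι_add_mul_swap a b)
    induction b using ExteriorAlgebra.induction with
    | algebraMap r => exact Algebra.commutes _ _
    | ι x =>
      rw [← mul_assoc, sw x v, neg_mul, mul_assoc, sw x w, mul_neg, neg_neg, mul_assoc]
    | mul a b ha hb => rw [mul_assoc, hb, ← mul_assoc, ha, mul_assoc]
    | add a b ha hb => rw [add_mul, mul_add, ha, hb]
  induction r using TensorProduct.induction_on with
  | zero => simp
  | add a b ha hb => rw [add_mul, mul_add, ha, hb]
  | tmul a b => simp [yg, key]

theorem anti4 : Anti4 (yg K 0) (yg K 2) (yg K 1) (yg K 3) := by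
  constructor <;> first | exact yg_sq K _ | exact yg_anti K _ _

end final

section generic

variable {R : Type*} [Ring R]

/-- the annihilator ideal -/
def annI (y1 y2 z1 z2 : R) : Ideal (Cen R) where
  carrier := {n | n • (y1 * y2) = 0 ∧ n • (z1 * z2) = 0}
  add_mem' := by
    rintro a b ⟨h1, h2⟩ ⟨h3, h4⟩
    exact ⟨by rw [add_smul, h1, h3, add_zero], by rw [add_smul, h2, h4, add_zero]⟩
  zero_mem' := ⟨zero_smul _ _, zero_smul _ _⟩
  smul_mem' := by
    rintro c a ⟨h1, h2⟩
    exact ⟨by rw [smul_eq_mul, mul_smul, h1, smul_zero],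
      by rw [smul_eq_mul, mul_smul, h2, smul_zero]⟩

theorem mem_annI (y1 y2 z1 z2 : R) (n : Cen R) : n ∈ annI y1 y2 z1 z2 ↔
    n • (y1 * y2) = 0 ∧ n • (z1 * z2) = 0 := Iff.rfl

theorem cen_exists (x : R) (hx : ∀ r, r * x = x * r) : ∃ c : Cen R, c • (1 : R) = x :=
  ⟨⟨x, Subring.mem_center_iff.2 hx⟩, mul_one _⟩

theorem good_of_mem {K : Type*} [Field K] [Algebra K R] {y1 y2 z1 z2 : R}
    (h : Anti4 y1 y2 z1 z2) {x1 x1' x2 x2' m11 m12 m21 m22 : Cen R}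
    (e11 : m11 • (1 : R) = y1 * z1) (e12 : m12 • (1 : R) = y1 * z2)
    (e21 : m21 • (1 : R) = y2 * z1) (e22 : m22 • (1 : R) = y2 * z2)
    (a : Matrix (Fin 2) (Fin 2) R)
    (ha : a ∈ Algebra.adjoin K {!![x1 • (1 : R), y1; z1, x1' • (1 : R)],
      !![x2 • (1 : R), y2; z2, x2' • (1 : R)]}) :
    GoodM y1 y2 z1 z2 (x1 - x1') (x2 - x2') (annI y1 y2 z1 z2) a := by
  induction ha using Algebra.adjoin_induction with
  | mem x hxx =>
    rcases hxx with rfl | rfl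
    · refine ⟨x1, x1', 1, 0, 1, 0, ?_, ?_, ?_⟩
      · simp only [one_smul, zero_smul, add_zero]
      · convert (annI y1 y2 z1 z2).zero_mem using 1; ring
      · convert (annI y1 y2 z1 z2).zero_mem using 1; ring
    · refine ⟨x2, x2', 0, 1, 0, 1, ?_, ?_, ?_⟩
      · simp only [one_smul, zero_smul, zero_add]
      · convert (annI y1 y2 z1 z2).zero_mem using 1; ring
      · convert (annI y1 y2 z1 z2).zero_mem using 1; ring
  | algebraMap r =>
    obtain ⟨c, hc⟩ := cen_exists (algebraMap K R r) fun g => (Algebra.commutes r g).symm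
    have : algebraMap K (Matrix (Fin 2) (Fin 2) R) r = !![c • 1, 0; 0, c • 1] := by
      ext i j
      fin_cases i <;> fin_cases j <;> simp [Matrix.algebraMap_matrix_apply, hc]
    rw [this]
    exact GoodM.scalar _ _ _ _ _ _ _ c
  | add x y _ _ hx hy => exact hx.add hy
  | mul x y _ _ hx hy =>
    have key : ∀ (m : Cen R) (t w : R), m • (1 : R) = t → t * w = 0 → m • w = 0 := by
      intro m t w h1 h2
      rw [← one_mul w, ← smul_mul_assoc, h1, h2]
    refine GoodM.mul h e11 e12 e21 e22 ?_ ?_ ?_ ?_ hx hy <;>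
    · refine (mem_annI _ _ _ _ _).2 ⟨?_, ?_⟩ <;>
        refine key _ _ _ (by assumption) ?_ <;>
        simp [mul_assoc, h.b1, h.b2, h.b3, h.b4, h.b5, h.b6, h.a1, h.a2, h.a3, h.a4,
          Anti4.l h.b1, Anti4.l h.b2, Anti4.l h.b3, Anti4.l h.b4, Anti4.l h.b5, Anti4.l h.b6,
          Anti4.z h.a1, Anti4.z h.a2, Anti4.z h.a3, Anti4.z h.a4]

theorem generic_id {K : Type*} [Field K] [Algebra K R] {y1 y2 z1 z2 x1 x1' x2 x2' : R}
    (h : Anti4 y1 y2 z1 z2) (c1 : ∀ r, r * x1 = x1 * r) (c1' : ∀ r, r * x1' = x1' * r)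
    (c2 : ∀ r, r * x2 = x2 * r) (c2' : ∀ r, r * x2' = x2' * r)
    (c11 : ∀ r, r * (y1 * z1) = (y1 * z1) * r) (c12 : ∀ r, r * (y1 * z2) = (y1 * z2) * r)
    (c21 : ∀ r, r * (y2 * z1) = (y2 * z1) * r) (c22 : ∀ r, r * (y2 * z2) = (y2 * z2) * r)
    (F : Subalgebra K (Matrix (Fin 2) (Fin 2) R))
    (hF : F = Algebra.adjoin K {!![x1, y1; z1, x1'], !![x2, y2; z2, x2']})
    (a₁ a₂ a₃ a₄ a₅ : Matrix (Fin 2) (Fin 2) R)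
    (h₁ : a₁ ∈ F) (h₂ : a₂ ∈ F) (h₃ : a₃ ∈ F) (h₄ : a₄ ∈ F) (h₅ : a₅ ∈ F) :
    ((a₁ * a₂ - a₂ * a₁) * a₅ - a₅ * (a₁ * a₂ - a₂ * a₁)) * (a₃ * a₄ - a₄ * a₃)
      + (a₁ * a₂ - a₂ * a₁) * ((a₃ * a₄ - a₄ * a₃) * a₅ - a₅ * (a₃ * a₄ - a₄ * a₃)) = 0 := by
  obtain ⟨x1, rfl⟩ := cen_exists _ c1
  obtain ⟨x1', rfl⟩ := cen_exists _ c1'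
  obtain ⟨x2, rfl⟩ := cen_exists _ c2
  obtain ⟨x2', rfl⟩ := cen_exists _ c2'
  obtain ⟨m11, e11⟩ := cen_exists _ c11
  obtain ⟨m12, e12⟩ := cen_exists _ c12
  obtain ⟨m21, e21⟩ := cen_exists _ c21
  obtain ⟨m22, e22⟩ := cen_exists _ c22
  subst hF
  have good := good_of_mem (K := K) h (x1 := x1) (x1' := x1') (x2 := x2) (x2' := x2')
    e11 e12 e21 e22
  have := main_gen h (I := annI y1 y2 z1 z2) (fun n hn => ((mem_annI _ _ _ _ n).1 hn).1)
    (fun n hn => ((mem_annI _ _ _ _ n).1 hn).2)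
    (good a₁ h₁) (good a₂ h₂) (good a₃ h₃) (good a₄ h₄) (good a₅ h₅)
  rw [← this]
  generalize a₁ * a₂ - a₂ * a₁ = u
  generalize a₃ * a₄ - a₄ * a₃ = v
  simp only [sub_mul, mul_sub, mul_assoc]
  abel

end generic


/- STATEMENT 2: [t1,t2,t5][t3,t4] + [t1,t2][t3,t4,t5] is a polynomial identity of F.
Here [a,b,c] = [[a,b],c] is the left-normed commutator. -/
theorem stmt2 (K : Type*) [Field K] [CharZero K]
    (a₁ a₂ a₃ a₄ a₅ : Matrix (Fin 2) (Fin 2) (FreeSuperComm K))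
    (h₁ : a₁ ∈ Falg K) (h₂ : a₂ ∈ Falg K) (h₃ : a₃ ∈ Falg K)
    (h₄ : a₄ ∈ Falg K) (h₅ : a₅ ∈ Falg K) :
    ((a₁ * a₂ - a₂ * a₁) * a₅ - a₅ * (a₁ * a₂ - a₂ * a₁)) * (a₃ * a₄ - a₄ * a₃)
      + (a₁ * a₂ - a₂ * a₁) * ((a₃ * a₄ - a₄ * a₃) * a₅ - a₅ * (a₃ * a₄ - a₄ * a₃)) = 0 := by
  exact generic_id (anti4 K) (xg_comm K 0) (xg_comm K 1) (xg_comm K 2) (xg_comm K 3)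
    (even_comm K 0 1) (even_comm K 0 3) (even_comm K 2 1) (even_comm K 2 3) (Falg K) rfl
    a₁ a₂ a₃ a₄ a₅ h₁ h₂ h₃ h₄ h₅
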